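/- arXiv:math/0403502 — 2 statements merged into one kernel-verified Lean document; each statement's English description precedes it below -/
import Mathlib

section
/- Let q be an indecomposable pattern of length k ≥ 2, and let q' be the pattern of length k+1 defined by q'(1) = 1 and q'(i+1) = q(i) + 1 for 1 ≤ i ≤ k. If the sequence (S_n(q))^{1/n} converges to a real number L, then the limit inferior of the sequence (S_n(q'))^{1/n} is at least 1 + L + 2√L. -/
/-- A permutation `p` of length `n` contains the pattern `q` of length `k`:
there are positions `f 0 < f 1 < … < f (k-1)` whose values are order-isomorphic to `q`. -/
def PermContains {n k : ℕ} (p : Equiv.Perm (Fin n)) (q : Equiv.Perm (Fin k)) : Prop :=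
  ∃ f : Fin k → Fin n, StrictMono f ∧ ∀ a b : Fin k, p (f a) < p (f b) ↔ q a < q b

/-- `p` avoids the pattern `q`. -/
def PermAvoids {n k : ℕ} (p : Equiv.Perm (Fin n)) (q : Equiv.Perm (Fin k)) : Prop :=
  ¬ PermContains p q

/-- `avoiders n q` is `S_n(q)`, the number of permutations of length `n` avoiding `q`. -/
noncomputable def avoiders (n : ℕ) {k : ℕ} (q : Equiv.Perm (Fin k)) : ℕ :=
  Nat.card {p : Equiv.Perm (Fin n) // PermAvoids p q}

/-- The pattern 12453 (0-indexed: 0,1,3,4,2). -/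
def pat12453 : Equiv.Perm (Fin 5) :=
  ⟨![0, 1, 3, 4, 2], ![0, 1, 4, 2, 3], by decide, by decide⟩

/-- `p i` is a left-to-right minimum of `p`: every earlier entry is larger. -/
def IsLtrMin {n : ℕ} (p : Equiv.Perm (Fin n)) (i : Fin n) : Prop :=
  ∀ j : Fin n, j < i → p i < p j

/-- The sequence `s` contains the pattern `q` using only positions satisfying `P`:
there is a subsequence, supported on positions satisfying `P`, order-isomorphic to `q`.
Taking `P := fun _ => True` gives ordinary pattern containment in the sequence `s`;
taking `P i := ¬ IsLtrMin p i` and `s := p` gives pattern containment in the string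
of remaining entries of a permutation `p`. -/
def ContainsOn {α : Type*} [LinearOrder α] {m k : ℕ} (s : Fin m → α)
    (P : Fin m → Prop) (q : Equiv.Perm (Fin k)) : Prop :=
  ∃ f : Fin k → Fin m, StrictMono f ∧ (∀ a : Fin k, P (f a)) ∧
    ∀ a b : Fin k, s (f a) < s (f b) ↔ q a < q b

/-- A pattern `q` of length `k` is indecomposable if it cannot be cut into two parts
so that all entries before the cut are larger than all entries after the cut:
there is no `r` with `1 ≤ r < k` such that the first `r` positions carry exactly
the top `r` values `{k-r, …, k-1}` (0-indexed). -/
def Indecomposable {k : ℕ} (q : Equiv.Perm (Fin k)) : Prop :=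
  ¬ ∃ r : ℕ, 1 ≤ r ∧ r < k ∧ ∀ i : Fin k, ((i : ℕ) < r ↔ k - r ≤ (q i : ℕ))

/-- A pattern `q` is layered: positions can be labelled by a monotone block function `b`
(whose fibers are then consecutive intervals, the layers) such that `q` is decreasing
within each layer and entries in earlier layers are smaller than those in later layers,
i.e. for `i < j`, `q j < q i` exactly when `i` and `j` are in the same layer. -/
def Layered {k : ℕ} (q : Equiv.Perm (Fin k)) : Prop :=
  ∃ b : Fin k → ℕ, Monotone b ∧ ∀ i j : Fin k, i < j → (q j < q i ↔ b i = b j)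

/-- The finite set `M` of lattice points contains the pattern `q`. -/
def MatContains {k : ℕ} (q : Equiv.Perm (Fin k)) (M : Finset (ℕ × ℕ)) : Prop :=
  ∃ f g : Fin k → ℕ, StrictMono f ∧ StrictMono g ∧ ∀ a, (f a, g (q a)) ∈ M

lemma MatContains.swap {k : ℕ} {q : Equiv.Perm (Fin k)} {M : Finset (ℕ × ℕ)}
    (h : MatContains q.symm (M.image Prod.swap)) : MatContains q M := by
  obtain ⟨f, g, hf, hg, h⟩ := h
  refine ⟨g, f, hg, hf, fun a => ?_⟩
  have := h (q a)
  simpa using this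

/-- The set of blocks of side length `B` that meet `M`. -/
def coarsen (B : ℕ) (M : Finset (ℕ × ℕ)) : Finset (ℕ × ℕ) :=
  M.image fun z => (z.1 / B, z.2 / B)

lemma MatContains.of_coarsen {k B : ℕ} {q : Equiv.Perm (Fin k)} {M : Finset (ℕ × ℕ)}
    (h : MatContains q (coarsen B M)) : MatContains q M := by
  obtain ⟨f, g, hf, hg, h⟩ := h
  have h' : ∀ a, ∃ z ∈ M, z.1 / B = f a ∧ z.2 / B = g (q a) := by
    intro a
    obtain ⟨z, hz, hz'⟩ := Finset.mem_image.1 (h a)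
    simp only [Prod.mk.injEq] at hz'
    exact ⟨z, hz, hz'⟩
  choose z hz h1 h2 using h'
  refine ⟨fun a => (z a).1, fun c => (z (q.symm c)).2, fun a b hab => ?_, fun a b hab => ?_,
    fun a => by simpa using hz a⟩
  · refine lt_of_not_ge fun hle => ?_
    have := Nat.div_le_div_right (c := B) hle
    rw [h1, h1] at this
    exact absurd (hf hab) (not_lt.2 this)
  · refine lt_of_not_ge fun hle => ?_
    have := Nat.div_le_div_right (c := B) hle
    rw [h2, h2] at this
    simp only [Equiv.apply_symm_apply] at this
    exact absurd (hg hab) (not_lt.2 this)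

/-- The points of `M` in the block `w`. -/
def blockAt (B : ℕ) (M : Finset (ℕ × ℕ)) (w : ℕ × ℕ) : Finset (ℕ × ℕ) :=
  M.filter fun z => (z.1 / B, z.2 / B) = w

lemma blockAt_subset {B : ℕ} (hB : 0 < B) (M : Finset (ℕ × ℕ)) (w : ℕ × ℕ) :
    blockAt B M w ⊆ Finset.Ico (B * w.1) (B * w.1 + B) ×ˢ Finset.Ico (B * w.2) (B * w.2 + B) := by
  intro z hz
  obtain ⟨-, rfl⟩ := Finset.mem_filter.1 hz
  have h1 := Nat.div_add_mod z.1 B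
  have h2 := Nat.div_add_mod z.2 B
  have h3 := Nat.mod_lt z.1 hB
  have h4 := Nat.mod_lt z.2 hB
  simp only [Finset.mem_product, Finset.mem_Ico]
  omega

lemma card_blockAt_le {B : ℕ} (hB : 0 < B) (M : Finset (ℕ × ℕ)) (w : ℕ × ℕ) :
    (blockAt B M w).card ≤ B ^ 2 := by
  refine (Finset.card_le_card (blockAt_subset hB M w)).trans ?_
  simp [sq]

/-- The blocks of `M` meeting at least `k` columns. -/
def wideBlocks (B k : ℕ) (M : Finset (ℕ × ℕ)) : Finset (ℕ × ℕ) :=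
  (coarsen B M).filter fun w => k ≤ ((blockAt B M w).image Prod.fst).card

lemma card_wideBlocks_column_le {k B : ℕ} (hB : 0 < B) {q : Equiv.Perm (Fin k)}
    {M : Finset (ℕ × ℕ)} (hM : ¬ MatContains q M) (i : ℕ) :
    ((wideBlocks B k M).filter fun w => w.1 = i).card ≤ 2 ^ B * k := by
  by_contra! hlt
  have hw : ∀ w ∈ (wideBlocks B k M).filter fun w => w.1 = i,
      ∃ s ⊆ (blockAt B M w).image Prod.fst, s.card = k := fun w hw =>
    Finset.exists_subset_card_eq (Finset.mem_filter.1 (Finset.mem_filter.1 hw).1).2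
  choose! s hs hsk using hw
  have hmaps : ∀ w ∈ (wideBlocks B k M).filter fun w => w.1 = i,
      s w ∈ (Finset.Ico (B * i) (B * i + B)).powerset := by
    intro w hw
    rw [Finset.mem_powerset]
    intro x hx
    obtain ⟨z, hz, rfl⟩ := Finset.mem_image.1 (hs w hw hx)
    have := (Finset.mem_product.1 (blockAt_subset hB M w hz)).1
    rwa [(Finset.mem_filter.1 hw).2] at this
  obtain ⟨S, -, hS⟩ := Finset.exists_lt_card_fiber_of_mul_lt_card_of_maps_to hmaps
    (n := k) (by simpa using hlt)
  set F := {w ∈ (wideBlocks B k M).filter fun w => w.1 = i | s w = S} with hF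
  have hF1 : ∀ w ∈ F, w ∈ (wideBlocks B k M).filter (fun w => w.1 = i) ∧ s w = S :=
    fun w hw => Finset.mem_filter.1 hw
  have hinj : Set.InjOn Prod.snd (F : Set (ℕ × ℕ)) := by
    intro w hw v hv h
    have h1 := (Finset.mem_filter.1 (hF1 w hw).1).2
    have h2 := (Finset.mem_filter.1 (hF1 v hv).1).2
    exact Prod.ext (h1.trans h2.symm) h
  have hJ : k ≤ (F.image Prod.snd).card := by
    rw [Finset.card_image_of_injOn hinj]; exact hS.le
  obtain ⟨J, hJF, hJk⟩ := Finset.exists_subset_card_eq hJ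
  have hSk : S.card = k := by
    obtain ⟨w, hw⟩ := Finset.card_pos.1 (lt_of_le_of_lt (Nat.zero_le _) hS)
    rw [← (hF1 w hw).2]
    exact hsk w (hF1 w hw).1
  have hpt : ∀ a, ∃ y, (S.orderEmbOfFin hSk a, y) ∈ M ∧ y / B = J.orderEmbOfFin hJk (q a) := by
    intro a
    obtain ⟨w, hw, hwj⟩ := Finset.mem_image.1 (hJF (J.orderEmbOfFin_mem hJk (q a)))
    have hmem : S.orderEmbOfFin hSk a ∈ s w := by
      rw [(hF1 w hw).2]; exact S.orderEmbOfFin_mem hSk a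
    obtain ⟨z, hz, hza⟩ := Finset.mem_image.1 (hs w (hF1 w hw).1 hmem)
    obtain ⟨hzM, hzw⟩ := Finset.mem_filter.1 hz
    refine ⟨z.2, ?_, ?_⟩
    · rw [← hza]; exact hzM
    · rw [← hwj, ← hzw]
  choose y hyM hyB using hpt
  refine hM ⟨S.orderEmbOfFin hSk, fun c => y (q.symm c), (S.orderEmbOfFin hSk).strictMono,
    fun a b hab => ?_, fun a => by simpa using hyM a⟩
  refine lt_of_not_ge fun hle => ?_
  have := Nat.div_le_div_right (c := B) hle
  rw [hyB, hyB] at this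
  simp only [Equiv.apply_symm_apply, OrderEmbedding.le_iff_le] at this
  exact absurd hab (not_lt.2 this)

/-- The square grid of side `n`. -/
def grid (n : ℕ) : Finset (ℕ × ℕ) := Finset.range n ×ˢ Finset.range n

lemma coarsen_subset_grid {B n : ℕ} {M : Finset (ℕ × ℕ)} (hM : M ⊆ grid (B * n)) :
    coarsen B M ⊆ grid n := by
  intro w hw
  obtain ⟨z, hz, rfl⟩ := Finset.mem_image.1 hw
  have := hM hz
  simp only [grid, Finset.mem_product, Finset.mem_range] at this ⊢
  exact ⟨Nat.div_lt_of_lt_mul this.1, Nat.div_lt_of_lt_mul this.2⟩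

lemma card_wideBlocks_le {k B n : ℕ} (hB : 0 < B) {q : Equiv.Perm (Fin k)}
    {M : Finset (ℕ × ℕ)} (hM : ¬ MatContains q M) (hMn : M ⊆ grid (B * n)) :
    (wideBlocks B k M).card ≤ 2 ^ B * k * n := by
  have := Finset.card_le_mul_card_image_of_maps_to (f := Prod.fst) (s := wideBlocks B k M)
    (t := Finset.range n) (fun w hw => by
      have := coarsen_subset_grid hMn (Finset.mem_filter.1 hw).1
      exact (Finset.mem_product.1 this).1) (2 ^ B * k)
    (fun i _ => card_wideBlocks_column_le hB hM i)
  simpa using this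

lemma coarsen_swap (B : ℕ) (M : Finset (ℕ × ℕ)) :
    coarsen B (M.image Prod.swap) = (coarsen B M).image Prod.swap := by
  simp only [coarsen, Finset.image_image]
  rfl

lemma blockAt_swap (B : ℕ) (M : Finset (ℕ × ℕ)) (w : ℕ × ℕ) :
    blockAt B (M.image Prod.swap) w.swap = (blockAt B M w).image Prod.swap := by
  ext ⟨x, y⟩
  obtain ⟨u, v⟩ := w
  simp [blockAt, and_comm]

lemma card_le_of_not_matContains {k B n : ℕ} (hB : 0 < B) {q : Equiv.Perm (Fin k)}
    {M : Finset (ℕ × ℕ)} (hM : ¬ MatContains q M) (hMn : M ⊆ grid (B * n)) :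
    M.card ≤ (k - 1) ^ 2 * (coarsen B M).card + 2 * (2 ^ B * k * n) * B ^ 2 := by
  set N := M.image Prod.swap with hN
  have hNc : ¬ MatContains q.symm N := fun h => hM h.swap
  have hNn : N ⊆ grid (B * n) := by
    intro z hz
    obtain ⟨w, hw, rfl⟩ := Finset.mem_image.1 hz
    have := hMn hw
    simp only [grid, Finset.mem_product] at this ⊢
    exact this.symm
  have hW := card_wideBlocks_le hB hM hMn
  have hT := card_wideBlocks_le hB hNc hNn
  have hcard : M.card = ∑ w ∈ coarsen B M, (blockAt B M w).card :=
    Finset.card_eq_sum_card_fiberwise fun z hz => Finset.mem_image_of_mem _ hz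
  have hblock : ∀ w ∈ coarsen B M, (blockAt B M w).card ≤ (k - 1) ^ 2 +
      ((if w ∈ wideBlocks B k M then B ^ 2 else 0) +
        (if w ∈ (wideBlocks B k N).image Prod.swap then B ^ 2 else 0)) := by
    intro w hw
    have hle := card_blockAt_le hB M w
    by_cases h1 : w ∈ wideBlocks B k M
    · rw [if_pos h1]; omega
    by_cases h2 : w ∈ (wideBlocks B k N).image Prod.swap
    · rw [if_pos h2]; omega
    rw [if_neg h1, if_neg h2]
    have h1' : ((blockAt B M w).image Prod.fst).card < k := by
      by_contra! h
      exact h1 (Finset.mem_filter.2 ⟨hw, h⟩)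
    have h2' : ((blockAt B M w).image Prod.snd).card < k := by
      by_contra! h
      refine h2 (Finset.mem_image.2 ⟨w.swap, Finset.mem_filter.2 ⟨?_, ?_⟩, w.swap_swap⟩)
      · rw [hN, coarsen_swap]; exact Finset.mem_image_of_mem _ hw
      · rw [hN, blockAt_swap, Finset.image_image]; exact h
    have hsub : blockAt B M w ⊆
        (blockAt B M w).image Prod.fst ×ˢ (blockAt B M w).image Prod.snd :=
      Finset.subset_product
    have := Finset.card_le_card hsub
    rw [Finset.card_product] at this
    have h3 := Nat.mul_le_mul (Nat.le_sub_one_of_lt h1') (Nat.le_sub_one_of_lt h2')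
    rw [sq]
    omega
  have hT' : ((wideBlocks B k N).image Prod.swap).card ≤ 2 ^ B * k * n :=
    Finset.card_image_le.trans hT
  have hind : ∀ S : Finset (ℕ × ℕ),
      ∑ w ∈ coarsen B M, (if w ∈ S then B ^ 2 else 0) ≤ S.card * B ^ 2 := by
    intro S
    rw [← Finset.sum_filter, Finset.sum_const, smul_eq_mul]
    refine Nat.mul_le_mul_right _ (Finset.card_le_card fun w hw => (Finset.mem_filter.1 hw).2)
  calc M.card ≤ _ := hcard.trans_le (Finset.sum_le_sum hblock)
    _ = (k - 1) ^ 2 * (coarsen B M).card +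
        (∑ w ∈ coarsen B M, (if w ∈ wideBlocks B k M then B ^ 2 else 0) +
          ∑ w ∈ coarsen B M, (if w ∈ (wideBlocks B k N).image Prod.swap then B ^ 2 else 0)) := by
        rw [Finset.sum_add_distrib, Finset.sum_add_distrib, Finset.sum_const, smul_eq_mul, mul_comm]
    _ ≤ (k - 1) ^ 2 * (coarsen B M).card + (2 ^ B * k * n * B ^ 2 + 2 ^ B * k * n * B ^ 2) := by
        gcongr
        · exact (hind _).trans (by gcongr)
        · exact (hind _).trans (by gcongr)
    _ = _ := by ring

/-- **Marcus–Tardos theorem** along the powers of `k ^ 2`: a finite set of lattice points in a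
square grid that avoids a pattern of length `k` has linearly many points. -/
lemma marcus_tardos {k : ℕ} (hk : 0 < k) (q : Equiv.Perm (Fin k)) :
    ∃ c : ℕ, ∀ i : ℕ, ∀ M : Finset (ℕ × ℕ), M ⊆ grid ((k ^ 2) ^ i) → ¬ MatContains q M →
      M.card ≤ c * (k ^ 2) ^ i := by
  set B := k ^ 2 with hBdef
  have hB : 0 < B := by positivity
  refine ⟨2 * (2 ^ B * k) * B ^ 2, fun i => ?_⟩
  set c := 2 * (2 ^ B * k) * B ^ 2 with hc
  have hc1 : 1 ≤ c := Nat.succ_le_of_lt (by positivity)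
  induction i with
  | zero =>
    intro M hM _
    have := Finset.card_le_card hM
    simp [grid] at this
    simp only [pow_zero, mul_one]
    omega
  | succ i ih =>
    intro M hM hq
    rw [pow_succ'] at hM
    have h1 := card_le_of_not_matContains hB hq hM
    have h2 := ih (coarsen B M) (coarsen_subset_grid hM) fun h => hq h.of_coarsen
    have h3 : (k - 1) ^ 2 + 1 ≤ B := by
      obtain ⟨j, rfl⟩ := Nat.exists_eq_succ_of_ne_zero hk.ne'
      simp only [hBdef, Nat.succ_eq_add_one, Nat.add_sub_cancel]
      nlinarith
    calc M.card ≤ _ := h1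
      _ ≤ (k - 1) ^ 2 * (c * B ^ i) + c * B ^ i := by
          refine Nat.add_le_add (by gcongr) (le_of_eq ?_)
          rw [hc]; ring
      _ = ((k - 1) ^ 2 + 1) * (c * B ^ i) := by ring
      _ ≤ B * (c * B ^ i) := by gcongr
      _ = c * B ^ (i + 1) := by ring

open Classical in
/-- The pattern-avoiding subsets of the square grid of side `n`. -/
noncomputable def avoidingSets (n : ℕ) {k : ℕ} (q : Equiv.Perm (Fin k)) :
    Finset (Finset (ℕ × ℕ)) :=
  (grid n).powerset.filter fun M => ¬ MatContains q M

lemma mem_avoidingSets {n k : ℕ} {q : Equiv.Perm (Fin k)} {M : Finset (ℕ × ℕ)} :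
    M ∈ avoidingSets n q ↔ M ⊆ grid n ∧ ¬ MatContains q M := by
  simp [avoidingSets]

lemma card_coarsen_fiber_le {B m : ℕ} (hB : 0 < B) (𝒜 : Finset (Finset (ℕ × ℕ)))
    {M' : Finset (ℕ × ℕ)} (hM' : M'.card ≤ m) :
    (𝒜.filter fun M => coarsen B M = M').card ≤ 2 ^ (B ^ 2 * m) := by
  set P : Finset (ℕ × ℕ) := M'.biUnion fun w =>
    Finset.Ico (B * w.1) (B * w.1 + B) ×ˢ Finset.Ico (B * w.2) (B * w.2 + B) with hP
  have hPc : P.card ≤ B ^ 2 * m := by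
    refine (Finset.card_biUnion_le_card_mul _ _ (B ^ 2) fun w _ => by simp [sq]).trans ?_
    rw [mul_comm]; gcongr
  have hsub : (𝒜.filter fun M => coarsen B M = M') ⊆ P.powerset := by
    intro M hM
    obtain ⟨-, rfl⟩ := Finset.mem_filter.1 hM
    rw [Finset.mem_powerset]
    intro z hz
    exact Finset.mem_biUnion.2 ⟨_, Finset.mem_image_of_mem _ hz,
      blockAt_subset hB M _ (Finset.mem_filter.2 ⟨hz, rfl⟩)⟩
  refine (Finset.card_le_card hsub).trans ?_
  rw [Finset.card_powerset]
  exact Nat.pow_le_pow_right (by norm_num) hPc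

lemma card_avoidingSets_le {k : ℕ} (hk : 2 ≤ k) (q : Equiv.Perm (Fin k)) :
    ∃ D : ℕ, ∀ i : ℕ, (avoidingSets ((k ^ 2) ^ i) q).card ≤ 2 ^ (D * (k ^ 2) ^ i) := by
  obtain ⟨c, hc⟩ := marcus_tardos (by omega) q
  set B := k ^ 2 with hBdef
  have hB : 2 ≤ B := by nlinarith
  refine ⟨B ^ 2 * c + 1, fun i => ?_⟩
  induction i with
  | zero =>
    have : (avoidingSets (B ^ 0) q).card ≤ 2 ^ 1 := by
      refine (Finset.card_le_card (t := (grid 1).powerset) fun M hM => ?_).trans (by simp [grid])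
      rw [pow_zero, mem_avoidingSets] at hM
      exact Finset.mem_powerset.2 hM.1
    exact this.trans (Nat.pow_le_pow_right (by norm_num) (by simp))
  | succ i ih =>
    have h1 : (avoidingSets (B ^ (i + 1)) q).card ≤
        2 ^ (B ^ 2 * (c * B ^ i)) * (avoidingSets (B ^ i) q).card := by
      refine Finset.card_le_mul_card_image_of_maps_to (f := coarsen B) (fun M hM => ?_) _
        (fun M' hM' => ?_)
      · rw [mem_avoidingSets, pow_succ'] at hM
        exact mem_avoidingSets.2 ⟨coarsen_subset_grid hM.1, fun h => hM.2 h.of_coarsen⟩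
      · rw [mem_avoidingSets] at hM'
        exact card_coarsen_fiber_le (by omega) _ (hc i M' hM'.1 hM'.2)
    calc _ ≤ _ := h1
      _ ≤ 2 ^ (B ^ 2 * (c * B ^ i)) * 2 ^ ((B ^ 2 * c + 1) * B ^ i) := by gcongr
      _ = 2 ^ (B ^ 2 * (c * B ^ i) + (B ^ 2 * c + 1) * B ^ i) := by rw [pow_add]
      _ ≤ _ := by
        refine Nat.pow_le_pow_right (by norm_num) ?_
        calc _ ≤ 2 * ((B ^ 2 * c + 1) * B ^ i) := by nlinarith [Nat.zero_le (B ^ i)]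
          _ ≤ B * ((B ^ 2 * c + 1) * B ^ i) := by gcongr
          _ = _ := by ring

lemma avoiders_le_card_avoidingSets (n : ℕ) {k : ℕ} (q : Equiv.Perm (Fin k)) :
    avoiders n q ≤ (avoidingSets n q).card := by
  let G (p : Equiv.Perm (Fin n)) : Finset (ℕ × ℕ) :=
    Finset.univ.image fun i : Fin n => ((i : ℕ), (p i : ℕ))
  have hG : ∀ p, PermAvoids p q → G p ∈ avoidingSets n q := by
    refine fun p hp => mem_avoidingSets.2 ⟨fun z hz => ?_, fun ⟨f, g, hf, hg, h⟩ => hp ?_⟩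
    · obtain ⟨i, -, rfl⟩ := Finset.mem_image.1 hz
      simp [grid]
    · have h' : ∀ a, ∃ i : Fin n, (i : ℕ) = f a ∧ (p i : ℕ) = g (q a) := fun a => by
        simpa [G] using h a
      choose i hi hpi using h'
      refine ⟨i, fun a b hab => ?_, fun a b => ?_⟩
      · rw [Fin.lt_def, hi, hi]; exact hf hab
      · rw [Fin.lt_def, hpi, hpi]; exact hg.lt_iff_lt
  have hinj : Function.Injective fun p : {p : Equiv.Perm (Fin n) // PermAvoids p q} =>
      (⟨G p.1, hG p.1 p.2⟩ : avoidingSets n q) := by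
    intro p p' h
    have h' : G p.1 = G p'.1 := congrArg Subtype.val h
    refine Subtype.ext (Equiv.ext fun i => ?_)
    have hi : ((i : ℕ), (p.1 i : ℕ)) ∈ G p'.1 := by
      rw [← h']; exact Finset.mem_image_of_mem _ (Finset.mem_univ i)
    obtain ⟨j, -, hj⟩ := Finset.mem_image.1 hi
    simp only [Prod.mk.injEq] at hj
    obtain rfl := Fin.ext hj.1
    exact (Fin.ext hj.2).symm
  simpa [avoiders] using Nat.card_le_card_of_injective _ hinj

lemma exists_frequently_avoiders_rpow_le {k : ℕ} (hk : 2 ≤ k) (q : Equiv.Perm (Fin k)) :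
    ∃ C : ℝ, ∃ᶠ n : ℕ in Filter.atTop, (avoiders n q : ℝ) ^ (1 / (n : ℝ)) ≤ C := by
  obtain ⟨D, hD⟩ := card_avoidingSets_le hk q
  have hB : 1 < k ^ 2 := by nlinarith
  refine ⟨2 ^ D, Filter.frequently_atTop.2 fun N =>
    ⟨(k ^ 2) ^ N, (Nat.lt_pow_self hB).le, ?_⟩⟩
  have hpos : (k ^ 2) ^ N ≠ 0 := by positivity
  have h : (avoiders ((k ^ 2) ^ N) q : ℝ) ≤ (2 ^ D) ^ ((k ^ 2) ^ N) := by
    rw [← pow_mul (2 : ℝ) D]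
    exact_mod_cast (avoiders_le_card_avoidingSets _ q).trans (hD N)
  calc _ ≤ (((2 : ℝ) ^ D) ^ ((k ^ 2) ^ N)) ^ (1 / (((k ^ 2) ^ N : ℕ) : ℝ)) :=
        Real.rpow_le_rpow (by positivity) h (by positivity)
    _ = 2 ^ D := by
        rw [one_div, Real.pow_rpow_inv_natCast (by positivity) hpos]

/-- The sequence `e`, indexed by a linear order, contains the pattern `q`. -/
def SeqContains {X Y : Type*} [LinearOrder X] [LinearOrder Y] {k : ℕ} (e : X → Y)
    (q : Equiv.Perm (Fin k)) : Prop :=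
  ∃ f : Fin k → X, StrictMono f ∧ ∀ a b : Fin k, e (f a) < e (f b) ↔ q a < q b

lemma card_not_seqContains {X Y : Type*} [LinearOrder X] [LinearOrder Y] [Fintype X] [Fintype Y]
    {n k : ℕ} (hX : Fintype.card X = n) (hY : Fintype.card Y = n) (q : Equiv.Perm (Fin k)) :
    Nat.card {e : X ≃ Y // ¬ SeqContains e q} = avoiders n q := by
  let φ := Fintype.orderIsoFinOfCardEq X hX
  let ψ := Fintype.orderIsoFinOfCardEq Y hY
  refine (Nat.card_congr (Equiv.subtypeEquiv (Equiv.equivCongr φ.toEquiv ψ.toEquiv)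
    fun p => not_congr ⟨?_, ?_⟩)).symm
  · rintro ⟨f, hf, h⟩
    exact ⟨fun a => φ (f a), φ.strictMono.comp hf, fun a b => by simp [h]⟩
  · rintro ⟨f, hf, h⟩
    refine ⟨fun a => φ.symm (f a), φ.symm.strictMono.comp hf, fun a b => ?_⟩
    rw [← h]
    simp

lemma Indecomposable.exists_lt {k : ℕ} {q : Equiv.Perm (Fin k)} (hq : Indecomposable q) {r : ℕ}
    (h1 : 1 ≤ r) (hr : r < k) : ∃ a b : Fin k, (a : ℕ) < r ∧ r ≤ (b : ℕ) ∧ q a < q b := by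
  by_contra! hlt
  have hne : ∀ a b : Fin k, (a : ℕ) < r → r ≤ (b : ℕ) → q b < q a := fun a b ha hb =>
    lt_of_le_of_ne (hlt a b ha hb) fun h => by
      have := q.injective h
      omega
  let r' : Fin k := ⟨r, hr⟩
  refine hq ⟨r, h1, hr, fun i => ⟨fun hi => ?_, fun hi => ?_⟩⟩
  · have hsub : (Finset.Ici r').map q.toEmbedding ⊆ Finset.Iio (q i) := by
      intro x hx
      obtain ⟨b, hb, rfl⟩ := Finset.mem_map.1 hx
      exact Finset.mem_Iio.2 (hne i b hi (show r' ≤ b from Finset.mem_Ici.1 hb))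
    have := Finset.card_le_card hsub
    simpa [r'] using this
  · by_contra! hri
    have hsub : (Finset.Iio r').map q.toEmbedding ⊆ Finset.Ioi (q i) := by
      intro x hx
      obtain ⟨a, ha, rfl⟩ := Finset.mem_map.1 hx
      exact Finset.mem_Ioi.2 (hne a i (show a < r' from Finset.mem_Iio.1 ha) hri)
    have := Finset.card_le_card hsub
    simp [r'] at this
    omega

/-- The sequence `e` avoids `q` and its `r` smallest values appear in decreasing order. -/
def AvoidsWithTail {X U : Type*} [LinearOrder X] [LinearOrder U] {r k : ℕ}
    (q : Equiv.Perm (Fin k)) (e : X ≃ Fin r ⊕ₗ U) : Prop :=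
  ¬ SeqContains e q ∧
    ∀ i j : Fin r, i < j → e.symm (toLex (Sum.inl j)) < e.symm (toLex (Sum.inl i))

section Extend

variable {X U : Type*} {r b N : ℕ}

/-- A rearrangement of the summands of an iterated sum type. -/
def sumRearrange (A B C D : Type*) : (A ⊕ B) ⊕ (C ⊕ D) ≃ C ⊕ ((A ⊕ D) ⊕ B) where
  toFun
    | .inl (.inl x) => .inr (.inl (.inl x))
    | .inl (.inr x) => .inr (.inr x)
    | .inr (.inl x) => .inl x
    | .inr (.inr x) => .inr (.inl (.inr x))
  invFun
    | .inr (.inl (.inl x)) => .inl (.inl x)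
    | .inr (.inr x) => .inl (.inr x)
    | .inl x => .inr (.inl x)
    | .inr (.inl (.inr x)) => .inr (.inr x)
  left_inv := by rintro ((_ | _) | (_ | _)) <;> rfl
  right_inv := by rintro (_ | ((_ | _) | _)) <;> rfl

/-- Append `N` new positions to the sequence `e` and insert `N` new values between its `r` smallest
values and the others. The `r` smallest old values and `b` values taken by new positions are
interleaved according to `cB`; the new positions taking these values and those taking `r` new
smallest values are interleaved according to `cA`. -/
def extend (e : X ≃ Fin r ⊕ₗ U) (cA cB : Fin r ⊕ Fin b ≃ Fin N) (β : Equiv.Perm (Fin b)) :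
    X ⊕ₗ Fin N ≃ Fin r ⊕ₗ (Fin N ⊕ₗ U) :=
  ofLex.trans <| (Equiv.sumCongr (e.trans ofLex)
    (cA.symm.trans (Equiv.sumCongr Fin.revPerm β))).trans <| (sumRearrange _ _ _ _).trans <|
    (Equiv.sumCongr (Equiv.refl _) ((Equiv.sumCongr cB (Equiv.refl _)).trans toLex)).trans toLex

variable {e : X ≃ Fin r ⊕ₗ U} {cA cB : Fin r ⊕ Fin b ≃ Fin N} {β : Equiv.Perm (Fin b)}

lemma extend_old_tail {x : X} {i : Fin r} (h : e x = toLex (.inl i)) :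
    extend e cA cB β (toLex (.inl x)) = toLex (.inr (toLex (.inl (cB (.inl i))))) := by
  simp [extend, h, sumRearrange]

lemma extend_old {x : X} {u : U} (h : e x = toLex (.inr u)) :
    extend e cA cB β (toLex (.inl x)) = toLex (.inr (toLex (.inr u))) := by
  simp [extend, h, sumRearrange]

lemma extend_new_tail (i : Fin r) :
    extend e cA cB β (toLex (.inr (cA (.inl i)))) = toLex (.inl i.rev) := by
  simp [extend, sumRearrange]

lemma extend_new (j : Fin b) :
    extend e cA cB β (toLex (.inr (cA (.inr j)))) =
      toLex (.inr (toLex (.inl (cB (.inr (β j)))))) := by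
  simp [extend, sumRearrange]

variable [LinearOrder U]

lemma extend_new_lt_iff (hB : StrictMono fun j => cB (.inr j)) (i j : Fin b) :
    extend e cA cB β (toLex (.inr (cA (.inr i)))) < extend e cA cB β (toLex (.inr (cA (.inr j)))) ↔
      β i < β j := by
  rw [extend_new, extend_new]
  exact (Sum.Lex.inr_lt_inr_iff.trans Sum.Lex.inl_lt_inl_iff).trans hB.lt_iff_lt

lemma extend_old_lt_iff (hB : StrictMono fun i => cB (.inl i)) (x y : X) :
    extend e cA cB β (toLex (.inl x)) < extend e cA cB β (toLex (.inl y)) ↔ e x < e y := by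
  rcases hx : e x with i | u <;> rcases hy : e y with j | v
  · rw [extend_old_tail hx, extend_old_tail hy]
    exact (Sum.Lex.inr_lt_inr_iff.trans Sum.Lex.inl_lt_inl_iff).trans
      (hB.lt_iff_lt.trans Sum.Lex.inl_lt_inl_iff.symm)
  · rw [extend_old_tail hx, extend_old hy]
    exact iff_of_true (Sum.Lex.inr_lt_inr_iff.2 (Sum.Lex.inl_lt_inr _ _)) (Sum.Lex.inl_lt_inr _ _)
  · rw [extend_old hx, extend_old_tail hy]
    exact iff_of_false (fun h => Sum.Lex.not_inr_lt_inl (Sum.Lex.inr_lt_inr_iff.1 h))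
      Sum.Lex.not_inr_lt_inl
  · rw [extend_old hx, extend_old hy]
    exact (Sum.Lex.inr_lt_inr_iff.trans Sum.Lex.inr_lt_inr_iff).trans
      Sum.Lex.inr_lt_inr_iff.symm

variable [LinearOrder X]

/-- An entry of an extended sequence above and to the right of another one is either an old entry
outside the tail or a new entry outside the new tail. -/
lemma extend_cases (he : ∀ i j : Fin r, i < j →
      e.symm (toLex (Sum.inl j)) < e.symm (toLex (Sum.inl i)))
    (hA : StrictMono fun i => cA (.inl i)) (hB : StrictMono fun i => cB (.inl i))
    {x y : X ⊕ₗ Fin N} (hxy : x < y) (hlt : extend e cA cB β x < extend e cA cB β y) :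
    (∃ z u, y = toLex (.inl z) ∧ e z = toLex (.inr u)) ∨ ∃ j, y = toLex (.inr (cA (.inr j))) := by
  rcases y with z | z
  · rcases hz : e z with i | u
    · exfalso
      rcases x with w | w
      · have hwz : w < z := Sum.Lex.inl_lt_inl_iff.1 hxy
        have hlt' := (extend_old_lt_iff hB w z).1 hlt
        rcases hw : e w with j | v
        · rw [hw, hz] at hlt'
          have := he j i (Sum.Lex.inl_lt_inl_iff.1 hlt')
          have h1 : e.symm (toLex (.inl i)) = z := e.symm_apply_eq.2 hz.symm
          have h2 : e.symm (toLex (.inl j)) = w := e.symm_apply_eq.2 hw.symm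
          rw [h1, h2] at this
          exact lt_asymm hwz this
        · rw [hw, hz] at hlt'
          exact Sum.Lex.not_inr_lt_inl hlt'
      · exact Sum.Lex.not_inr_lt_inl hxy
    · exact Or.inl ⟨z, u, rfl, hz⟩
  · obtain ⟨i | j, rfl⟩ := cA.surjective z
    · exfalso
      change extend e cA cB β x < extend e cA cB β (toLex (.inr (cA (.inl i)))) at hlt
      rw [extend_new_tail] at hlt
      rcases x with w | w
      · rcases hw : e w with j | v
        · erw [extend_old_tail hw] at hlt
          exact Sum.Lex.not_inr_lt_inl hlt
        · erw [extend_old hw] at hlt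
          exact Sum.Lex.not_inr_lt_inl hlt
      · obtain ⟨j | j, rfl⟩ := cA.surjective w
        · erw [extend_new_tail] at hlt
          have h1 := hA.lt_iff_lt.1 (Sum.Lex.inr_lt_inr_iff.1 hxy)
          have h2 := Fin.rev_lt_rev.1 (Sum.Lex.inl_lt_inl_iff.1 hlt)
          exact lt_asymm h1 h2
        · erw [extend_new] at hlt
          exact Sum.Lex.not_inr_lt_inl hlt
    · exact Or.inr ⟨j, rfl⟩

variable {k : ℕ} {q : Equiv.Perm (Fin k)} {q' : Equiv.Perm (Fin (k + 1))}

lemma AvoidsWithTail.extend (hk : 2 ≤ k) (hq : Indecomposable q)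
    (hq'0 : q' 0 = 0) (hq' : ∀ i : Fin k, q' i.succ = (q i).succ)
    (he : AvoidsWithTail q' e) (hβ : PermAvoids β q)
    (hA : StrictMono fun i => cA (.inl i)) (hA' : StrictMono fun i => cA (.inr i))
    (hB : StrictMono fun i => cB (.inl i)) (hB' : StrictMono fun i => cB (.inr i)) :
    AvoidsWithTail q' (extend e cA cB β) := by
  refine ⟨fun ⟨f, hf, h⟩ => ?_, fun i j hij => ?_⟩
  · have hcases : ∀ a : Fin k, (∃ z u, f a.succ = toLex (.inl z) ∧ e z = toLex (.inr u)) ∨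
        ∃ j, f a.succ = toLex (.inr (cA (.inr j))) := fun a =>
      extend_cases he.2 hA hB (hf a.succ_pos) ((h _ _).2 (by rw [hq'0, hq']; exact Fin.succ_pos _))
    have hsucc : ∀ a b : Fin k, _root_.extend e cA cB β (f a.succ) <
        _root_.extend e cA cB β (f b.succ) ↔ q a < q b := fun a b => by
      rw [h, hq', hq', Fin.succ_lt_succ_iff]
    by_cases hnew : ∀ a : Fin k, ∃ j, f a.succ = toLex (.inr (cA (.inr j)))
    · choose g hg using hnew
      refine hβ ⟨g, fun a b hab => ?_, fun a b => ?_⟩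
      · have := hf (Fin.succ_lt_succ_iff.2 hab)
        rw [hg, hg] at this
        exact hA'.lt_iff_lt.1 (Sum.Lex.inr_lt_inr_iff.1 this)
      · rw [← hsucc, hg, hg, extend_new_lt_iff hB']
    by_cases hold : ∀ a : Fin k, ∃ z, f a.succ = toLex (.inl z)
    · have hall : ∀ a, ∃ z, f a = toLex (.inl z) := by
        refine Fin.cases ?_ hold
        obtain ⟨z, hz⟩ := hold ⟨0, by omega⟩
        have h0 : f 0 < toLex (.inl z) := hz ▸ hf (Fin.succ_pos _)
        rcases h1 : f 0 with w | w
        · exact ⟨w, rfl⟩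
        · rw [h1] at h0
          exact absurd h0 Sum.Lex.not_inr_lt_inl
      choose g hg using hall
      refine he.1 ⟨g, fun a b hab => ?_, fun a b => ?_⟩
      · have := hf hab
        rw [hg, hg] at this
        exact Sum.Lex.inl_lt_inl_iff.1 this
      · rw [← h, hg, hg, extend_old_lt_iff hB]
    · push Not at hnew hold
      classical
      have hex : ∃ n, ∃ hn : n < k, ∃ j, f (Fin.succ ⟨n, hn⟩) = toLex (.inr (cA (.inr j))) := by
        obtain ⟨a, ha⟩ := hold
        refine ⟨a, a.2, (hcases a).resolve_left ?_⟩
        rintro ⟨z, u, hz, -⟩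
        exact ha z hz
      obtain ⟨hr, j, hj⟩ := Nat.find_spec hex
      have hlow : ∀ a : Fin k, (a : ℕ) < Nat.find hex →
          ∃ z u, f a.succ = toLex (.inl z) ∧ e z = toLex (.inr u) := fun a ha =>
        (hcases a).resolve_right fun h' => Nat.find_min hex ha ⟨a.2, h'⟩
      have hhigh : ∀ a : Fin k, Nat.find hex ≤ (a : ℕ) →
          ∃ j, f a.succ = toLex (.inr (cA (.inr j))) := by
        refine fun a ha => (hcases a).resolve_left ?_
        rintro ⟨z, u, hz, -⟩
        have : f (Fin.succ ⟨Nat.find hex, hr⟩) ≤ f a.succ :=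
          hf.monotone (Fin.succ_le_succ_iff.2 ha)
        rw [hj, hz] at this
        exact absurd this (not_le.2 (Sum.Lex.inl_lt_inr _ _))
      have hpos : 1 ≤ Nat.find hex := by
        by_contra! h0
        obtain ⟨a, ha⟩ := hnew
        obtain ⟨j, hj⟩ := hhigh a (by omega)
        exact ha j hj
      obtain ⟨a, c, ha, hc, hac⟩ := hq.exists_lt hpos hr
      obtain ⟨z, u, hz, hu⟩ := hlow a ha
      obtain ⟨j, hj⟩ := hhigh c hc
      have := (hsucc a c).2 hac
      rw [hz, hj, extend_old hu, extend_new] at this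
      exact Sum.Lex.not_inr_lt_inl (Sum.Lex.inr_lt_inr_iff.1 this)
  · have hsymm : ∀ i, (_root_.extend e cA cB β).symm (toLex (.inl i)) =
        toLex (.inr (cA (.inl i.rev))) := fun i => by
      rw [Equiv.symm_apply_eq, extend_new_tail, Fin.rev_rev]
    rw [hsymm, hsymm]
    exact Sum.Lex.inr_lt_inr_iff.2 (hA (Fin.rev_lt_rev.2 hij))

end Extend

section Count

variable {X U : Type*} {r b : ℕ}

lemma card_compl_of_mem_powersetCard {A : Finset (Fin (r + b))}
    (hA : A ∈ Finset.powersetCard r Finset.univ) : Aᶜ.card = b := by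
  rw [Finset.card_compl, (Finset.mem_powersetCard.1 hA).2, Fintype.card_fin, Nat.add_sub_cancel_left]

/-- The order-preserving splitting of `Fin (r + b)` into a set of size `r` and its complement. -/
def splitting (A : Finset.powersetCard r (Finset.univ : Finset (Fin (r + b)))) :
    Fin r ⊕ Fin b ≃ Fin (r + b) :=
  finSumEquivOfFinset (Finset.mem_powersetCard.1 A.2).2 (card_compl_of_mem_powersetCard A.2)

variable (A : Finset.powersetCard r (Finset.univ : Finset (Fin (r + b))))

lemma strictMono_splitting_inl : StrictMono fun i => splitting A (.inl i) := fun i j hij => by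
  simpa [splitting] using hij

lemma strictMono_splitting_inr : StrictMono fun i => splitting A (.inr i) := fun i j hij => by
  simpa [splitting] using hij

lemma splitting_inl_mem (i : Fin r) : splitting A (.inl i) ∈ A.1 := by
  simp [splitting]

lemma splitting_inr_notMem (j : Fin b) : splitting A (.inr j) ∉ A.1 := by
  simpa [splitting] using Finset.mem_compl.1 (Finset.orderEmbOfFin_mem A.1ᶜ _ j)

lemma mem_positions_iff (e : X ≃ Fin r ⊕ₗ U)
    (B : Finset.powersetCard r (Finset.univ : Finset (Fin (r + b)))) (β : Equiv.Perm (Fin b))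
    (y : Fin (r + b)) : y ∈ A.1 ↔
      ∃ i, extend e (splitting A) (splitting B) β (toLex (.inr y)) = toLex (.inl i) := by
  obtain ⟨i | j, rfl⟩ := (splitting A).surjective y
  · exact iff_of_true (splitting_inl_mem A i) ⟨_, extend_new_tail i⟩
  · refine iff_of_false (splitting_inr_notMem A j) ?_
    rintro ⟨i, hi⟩
    rw [extend_new] at hi
    simp at hi

lemma mem_values_iff (e : X ≃ Fin r ⊕ₗ U)
    (B : Finset.powersetCard r (Finset.univ : Finset (Fin (r + b)))) (β : Equiv.Perm (Fin b))
    (y : Fin (r + b)) : y ∈ B.1 ↔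
      ∃ x, extend e (splitting A) (splitting B) β (toLex (.inl x)) =
        toLex (.inr (toLex (.inl y))) := by
  constructor
  · intro hy
    obtain ⟨i | j, rfl⟩ := (splitting B).surjective y
    · exact ⟨e.symm (toLex (.inl i)), extend_old_tail (e.apply_symm_apply _)⟩
    · exact absurd hy (splitting_inr_notMem B j)
  · rintro ⟨x, hx⟩
    rcases h : e x with i | u
    · rw [extend_old_tail h] at hx
      simp only [EmbeddingLike.apply_eq_iff_eq, Sum.inr.injEq, Sum.inl.injEq] at hx
      rw [← hx]
      exact splitting_inl_mem B i
    · rw [extend_old h] at hx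
      simp at hx

lemma extend_injective : Function.Injective
    fun z : (X ≃ Fin r ⊕ₗ U) × (Finset.powersetCard r (Finset.univ : Finset (Fin (r + b)))) ×
        (Finset.powersetCard r (Finset.univ : Finset (Fin (r + b)))) × Equiv.Perm (Fin b) =>
      extend z.1 (splitting z.2.1) (splitting z.2.2.1) z.2.2.2 := by
  rintro ⟨e, A, B, β⟩ ⟨e', A', B', β'⟩ h
  change extend e (splitting A) (splitting B) β = extend e' (splitting A') (splitting B') β' at h
  obtain rfl : A = A' := Subtype.ext <| Finset.ext fun y => by
    rw [mem_positions_iff A e B β, h, ← mem_positions_iff]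
  obtain rfl : B = B' := Subtype.ext <| Finset.ext fun y => by
    rw [mem_values_iff A e B β, h, ← mem_values_iff]
  obtain rfl : e = e' := by
    ext x
    have hx := congrArg (fun E => E (toLex (.inl x))) h
    rcases h1 : e x with i | u <;> rcases h2 : e' x with j | v
    · rw [extend_old_tail h1, extend_old_tail h2] at hx
      simp at hx
      rw [hx]
    · rw [extend_old_tail h1, extend_old h2] at hx
      simp at hx
    · rw [extend_old h1, extend_old_tail h2] at hx
      simp at hx
    · rw [extend_old h1, extend_old h2] at hx
      simp at hx
      rw [hx]
  obtain rfl : β = β' := by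
    refine Equiv.ext fun j => ?_
    have hj := congrArg (fun E => E (toLex (.inr (splitting A (.inr j))))) h
    simp only [extend_new] at hj
    simpa using hj
  rfl

variable {k : ℕ} {q : Equiv.Perm (Fin k)} {q' : Equiv.Perm (Fin (k + 1))}

lemma card_avoidsWithTail_extend [LinearOrder X] [LinearOrder U] [Fintype X] [Fintype U]
    (hk : 2 ≤ k) (hq : Indecomposable q)
    (hq'0 : q' 0 = 0) (hq' : ∀ i : Fin k, q' i.succ = (q i).succ) :
    Nat.card {e : X ≃ Fin r ⊕ₗ U // AvoidsWithTail q' e} *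
        ((r + b).choose r ^ 2 * avoiders b q) ≤
      Nat.card {e : X ⊕ₗ Fin (r + b) ≃ Fin r ⊕ₗ (Fin (r + b) ⊕ₗ U) // AvoidsWithTail q' e} := by
  let F (z : {e : X ≃ Fin r ⊕ₗ U // AvoidsWithTail q' e} ×
      (Finset.powersetCard r (Finset.univ : Finset (Fin (r + b)))) ×
      (Finset.powersetCard r (Finset.univ : Finset (Fin (r + b)))) ×
      {β : Equiv.Perm (Fin b) // PermAvoids β q}) :
      {e : X ⊕ₗ Fin (r + b) ≃ Fin r ⊕ₗ (Fin (r + b) ⊕ₗ U) // AvoidsWithTail q' e} :=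
    ⟨extend z.1.1 (splitting z.2.1) (splitting z.2.2.1) z.2.2.2.1,
      z.1.2.extend hk hq hq'0 hq' z.2.2.2.2 (strictMono_splitting_inl _)
        (strictMono_splitting_inr _) (strictMono_splitting_inl _) (strictMono_splitting_inr _)⟩
  have hF : Function.Injective F := by
    rintro ⟨⟨e, he⟩, A, B, ⟨β, hβ⟩⟩ ⟨⟨e', he'⟩, A', B', ⟨β', hβ'⟩⟩ h
    have := @extend_injective X U r b (e, A, B, β) (e', A', B', β') (congrArg Subtype.val h)
    simp only [Prod.mk.injEq] at this
    obtain ⟨rfl, rfl, rfl, rfl⟩ := this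
    rfl
  have := Nat.card_le_card_of_injective F hF
  simp only [Nat.card_prod, Nat.card_eq_fintype_card (α := Finset.powersetCard r _),
    Fintype.card_coe, Finset.card_powersetCard, Finset.card_univ, Fintype.card_fin] at this
  calc _ = _ := by rw [avoiders]; ring
    _ ≤ _ := this

lemma exists_card_avoidsWithTail_ge (hk : 2 ≤ k) (hq : Indecomposable q)
    (hq'0 : q' 0 = 0) (hq' : ∀ i : Fin k, q' i.succ = (q i).succ) (r b s t : ℕ) :
    ∃ (X U : Type) (_ : LinearOrder X) (_ : LinearOrder U) (_ : Fintype X) (_ : Fintype U),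
      Fintype.card X = t * (r + b) + (r + s) ∧ Fintype.card U = t * (r + b) + s ∧
      ((r + b).choose r ^ 2 * avoiders b q) ^ t ≤
        Nat.card {e : X ≃ Fin r ⊕ₗ U // AvoidsWithTail q' e} := by
  induction t with
  | zero =>
    refine ⟨(Fin r ⊕ₗ Fin s)ᵒᵈ, Fin s, inferInstance, inferInstance,
      inferInstanceAs (Fintype (Fin r ⊕ Fin s)), inferInstance, ?_, by simp, ?_⟩
    · rw [zero_mul, zero_add]
      exact (Fintype.card_sum (α := Fin r) (β := Fin s)).trans (by simp)
    · rw [pow_zero, Nat.one_le_iff_ne_zero, ← Nat.pos_iff_ne_zero]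
      have : Nonempty {e : (Fin r ⊕ₗ Fin s)ᵒᵈ ≃ Fin r ⊕ₗ Fin s // AvoidsWithTail q' e} := by
        refine ⟨OrderDual.ofDual, ?_, fun i j hij => ?_⟩
        · rintro ⟨f, hf, h⟩
          have h01 : (0 : Fin (k + 1)) < Fin.succ ⟨0, by omega⟩ := Fin.succ_pos _
          have h1 := (h 0 (Fin.succ ⟨0, by omega⟩)).2 (by rw [hq'0, hq']; exact Fin.succ_pos _)
          exact lt_asymm h1 (hf h01)
        · exact OrderDual.toDual_lt_toDual.2 (Sum.Lex.inl_lt_inl_iff.2 hij)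
      exact Nat.card_pos
  | succ t ih =>
    obtain ⟨X, U, _, _, _, _, hX, hU, hc⟩ := ih
    refine ⟨X ⊕ₗ Fin (r + b), Fin (r + b) ⊕ₗ U, inferInstance, inferInstance,
      inferInstanceAs (Fintype (X ⊕ Fin (r + b))), inferInstanceAs (Fintype (Fin (r + b) ⊕ U)),
      ?_, ?_, ?_⟩
    · refine (Fintype.card_sum (α := X) (β := Fin (r + b))).trans ?_
      rw [hX, Fintype.card_fin]; ring
    · refine (Fintype.card_sum (α := Fin (r + b)) (β := U)).trans ?_
      rw [hU, Fintype.card_fin]; ring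
    · rw [pow_succ]
      exact (Nat.mul_le_mul_right _ hc).trans (card_avoidsWithTail_extend hk hq hq'0 hq')

lemma pow_le_avoiders_prepend (hk : 2 ≤ k) (hq : Indecomposable q)
    (hq'0 : q' 0 = 0) (hq' : ∀ i : Fin k, q' i.succ = (q i).succ) (r b s t : ℕ) :
    ((r + b).choose r ^ 2 * avoiders b q) ^ t ≤ avoiders (t * (r + b) + (r + s)) q' := by
  obtain ⟨X, U, _, _, _, _, hX, hU, hc⟩ := exists_card_avoidsWithTail_ge hk hq hq'0 hq' r b s t
  let _ : Fintype (Fin r ⊕ₗ U) := inferInstanceAs (Fintype (Fin r ⊕ U))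
  have hY : Fintype.card (Fin r ⊕ₗ U) = t * (r + b) + (r + s) := by
    refine (Fintype.card_sum (α := Fin r) (β := U)).trans ?_
    rw [hU, Fintype.card_fin]; ring
  rw [← card_not_seqContains hX hY]
  exact hc.trans (Nat.card_le_card_of_injective
    (Subtype.map id fun e he => he.1) (Subtype.map_injective _ Function.injective_id))

end Count

lemma one_le_avoiders {k : ℕ} {q : Equiv.Perm (Fin k)} (hk : 2 ≤ k) (hq : Indecomposable q)
    (n : ℕ) : 1 ≤ avoiders n q := by
  have : Nonempty {p : Equiv.Perm (Fin n) // PermAvoids p q} := by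
    refine ⟨Fin.revPerm, fun ⟨f, hf, h⟩ => ?_⟩
    obtain ⟨a, b, ha, hb, hab⟩ := hq.exists_lt (le_refl 1) (by omega)
    have h1 := (h a b).2 hab
    have h2 := hf (show a < b from Fin.lt_def.2 (lt_of_lt_of_le ha hb))
    exact lt_asymm (Fin.rev_lt_rev.1 h1) h2
  exact Nat.card_pos

section Asymptotics

open Filter Topology

/-- A power lower bound along arithmetic progressions bounds the growth rate from below. -/
lemma eventually_le_rpow_of_pow_le {u : ℕ → ℕ} {K N r : ℕ} (hN : 0 < N) (hK : 1 ≤ K)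
    (h : ∀ s t, K ^ t ≤ u (t * N + (r + s))) {c : ℝ} (hc : c < (K : ℝ) ^ (1 / (N : ℝ))) :
    ∀ᶠ n : ℕ in atTop, c ≤ (u n : ℝ) ^ (1 / (n : ℝ)) := by
  have hK' : (1 : ℝ) ≤ K := by exact_mod_cast hK
  have hlim : Tendsto (fun n : ℕ => (K : ℝ) ^ (1 / (N : ℝ) - ((r : ℝ) / N + 1) / n)) atTop
      (𝓝 ((K : ℝ) ^ (1 / (N : ℝ) - 0))) :=
    tendsto_const_nhds.rpow (tendsto_const_nhds.sub (tendsto_const_div_atTop_nhds_zero_nat _))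
      (Or.inl (by positivity))
  rw [sub_zero] at hlim
  filter_upwards [hlim.eventually_const_lt hc, eventually_ge_atTop (r + 1)] with n hn hr
  have hn0 : (0 : ℝ) < n := by exact_mod_cast (by omega : 0 < n)
  have hN0 : (0 : ℝ) < N := by exact_mod_cast hN
  set t := (n - r) / N with ht
  have hdiv := Nat.div_add_mod (n - r) N
  have hmod := Nat.mod_lt (n - r) hN
  have hnt : n = t * N + (r + (n - r) % N) := by
    rw [mul_comm t N]; lia
  have hu : (K : ℝ) ^ t ≤ u n := by
    have := h ((n - r) % N) t
    rw [← hnt] at this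
    exact_mod_cast this
  have htn : (n : ℝ) ≤ t * N + r + N := by
    have : n ≤ t * N + r + N := by lia
    exact_mod_cast this
  calc c ≤ _ := hn.le
    _ ≤ (K : ℝ) ^ ((t : ℝ) * (1 / n)) := by
        refine Real.rpow_le_rpow_of_exponent_le hK' ?_
        rw [mul_one_div, le_div_iff₀ hn0, sub_mul, div_mul_cancel₀ _ hn0.ne', sub_le_iff_le_add,
          one_div, inv_mul_le_iff₀ hN0]
        field_simp
        linarith
    _ = ((K : ℝ) ^ t) ^ (1 / (n : ℝ)) := by
        rw [Real.rpow_mul (by positivity), Real.rpow_natCast]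
    _ ≤ _ := Real.rpow_le_rpow (by positivity) hu (by positivity)

/-- A sequence of positive numbers whose growth rate exceeds `y` dominates a multiple of `y ^ n`. -/
lemma exists_mul_pow_le {u : ℕ → ℕ} (hu : ∀ n, 1 ≤ u n) {L y : ℝ} (hy : 0 < y) (hyL : y < L)
    (hL : Tendsto (fun n : ℕ => (u n : ℝ) ^ (1 / (n : ℝ))) atTop (𝓝 L)) :
    ∃ δ : ℝ, 0 < δ ∧ ∀ n, δ * y ^ n ≤ u n := by
  obtain ⟨M, hM⟩ := eventually_atTop.1 (hL.eventually_const_lt hyL)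
  set m := max 1 y with hm
  have hm1 : 1 ≤ m := le_max_left _ _
  have hym : y ≤ m := le_max_right _ _
  refine ⟨(m ^ (M + 1))⁻¹, by positivity, fun n => ?_⟩
  have hun : (1 : ℝ) ≤ u n := by exact_mod_cast hu n
  rw [inv_mul_le_iff₀ (by positivity)]
  rcases le_or_gt n M with hn | hn
  · calc y ^ n ≤ m ^ n := by gcongr
      _ ≤ m ^ (M + 1) := pow_le_pow_right₀ hm1 (by omega)
      _ ≤ m ^ (M + 1) * u n := le_mul_of_one_le_right (by positivity) hun
  · have h1 := hM n hn.le
    have h2 : y ^ n ≤ u n := by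
      calc y ^ n ≤ ((u n : ℝ) ^ (1 / (n : ℝ))) ^ n := by gcongr
        _ = u n := by rw [one_div, Real.rpow_inv_natCast_pow (by positivity) (by omega)]
    exact h2.trans (le_mul_of_one_le_left (by positivity) (one_le_pow₀ hm1))

lemma exists_choose_mul_pow_ge (x : ℝ) (N : ℕ) :
    ∃ r b, r + b = N ∧ (1 + x) ^ N / (N + 1) ≤ (N.choose r : ℝ) * x ^ b := by
  by_contra! h
  have h1 : (1 + x) ^ N = ∑ r ∈ Finset.range (N + 1), (N.choose r : ℝ) * x ^ (N - r) := by
    rw [add_pow]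
    exact Finset.sum_congr rfl fun r _ => by ring
  have h2 : ∑ r ∈ Finset.range (N + 1), (N.choose r : ℝ) * x ^ (N - r) <
      ∑ r ∈ Finset.range (N + 1), (1 + x) ^ N / (N + 1) :=
    Finset.sum_lt_sum_of_nonempty (by simp) fun r hr =>
      h r (N - r) (by have := Finset.mem_range.1 hr; omega)
  rw [← h1, Finset.sum_const, Finset.card_range, nsmul_eq_mul] at h2
  push_cast at h2
  rw [mul_div_cancel₀ _ (by positivity)] at h2
  exact lt_irrefl _ h2

lemma tendsto_const_div_sq_rpow {δ : ℝ} (hδ : 0 < δ) :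
    Tendsto (fun N : ℕ => (δ / ((N : ℝ) + 1) ^ 2) ^ (1 / (N : ℝ))) atTop (𝓝 1) := by
  have h1 : Tendsto (fun N : ℕ => δ ^ (1 / (N : ℝ))) atTop (𝓝 (δ ^ (0 : ℝ))) :=
    tendsto_const_nhds.rpow (tendsto_const_div_atTop_nhds_zero_nat 1) (Or.inl hδ.ne')
  have h2 : Tendsto (fun N : ℕ => ((N : ℝ) + 1) ^ (1 / (N : ℝ))) atTop (𝓝 1) := by
    refine ((tendsto_rpow_div_mul_add 1 1 (-1) one_ne_zero.symm).comp
      (tendsto_natCast_atTop_atTop.comp (tendsto_add_atTop_nat 1))).congr fun N => ?_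
    simp
  have h3 := h1.div (h2.pow 2) (by norm_num)
  rw [Real.rpow_zero, one_pow, div_one] at h3
  refine h3.congr fun N => ?_
  rw [Pi.div_apply, Real.div_rpow hδ.le (by positivity), ← Real.rpow_natCast (_ ^ (_ : ℝ)),
    ← Real.rpow_natCast (_ + 1 : ℝ), ← Real.rpow_mul (by positivity),
    ← Real.rpow_mul (by positivity), mul_comm]

/-- The growth rate of `avoiders n q'` is at least `(1 + x) ^ 2` whenever `x ^ 2` lies below the
growth rate of `avoiders n q`. -/
lemma eventually_le_avoiders_prepend_rpow {k : ℕ} {q : Equiv.Perm (Fin k)}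
    {q' : Equiv.Perm (Fin (k + 1))} (hk : 2 ≤ k) (hq : Indecomposable q)
    (hq'0 : q' 0 = 0) (hq' : ∀ i : Fin k, q' i.succ = (q i).succ) {L x c : ℝ}
    (hL : Tendsto (fun n : ℕ => (avoiders n q : ℝ) ^ (1 / (n : ℝ))) atTop (𝓝 L))
    (hx : 0 < x) (hxL : x ^ 2 < L) (hc : c < (1 + x) ^ 2) :
    ∀ᶠ n : ℕ in atTop, c ≤ (avoiders n q' : ℝ) ^ (1 / (n : ℝ)) := by
  obtain ⟨δ, hδ, hδq⟩ := exists_mul_pow_le (one_le_avoiders hk hq) (sq_pos_of_pos hx) hxL hL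
  have hlim := (tendsto_const_div_sq_rpow hδ).mul_const ((1 + x) ^ 2)
  rw [one_mul] at hlim
  obtain ⟨N, hN, hN0⟩ := ((hlim.eventually_const_lt hc).and (eventually_gt_atTop 0)).exists
  obtain ⟨r, b, rfl, hrb⟩ := exists_choose_mul_pow_ge x N
  refine eventually_le_rpow_of_pow_le hN0 ?_
    (fun s t => pow_le_avoiders_prepend hk hq hq'0 hq' r b s t) (hN.trans_le ?_)
  · exact Nat.mul_pos (pow_pos (Nat.choose_pos (Nat.le_add_right r b)) 2) (one_le_avoiders hk hq b)
  · set M := r + b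
    have hK : δ / ((M : ℝ) + 1) ^ 2 * ((1 + x) ^ 2) ^ M ≤
        ((M.choose r ^ 2 * avoiders b q : ℕ) : ℝ) := by
      push_cast
      calc _ = ((1 + x) ^ M / (M + 1)) ^ 2 * δ := by
            rw [div_pow, ← pow_mul, ← pow_mul, mul_comm 2 M]; ring
        _ ≤ ((M.choose r : ℝ) * x ^ b) ^ 2 * δ := by gcongr
        _ = (M.choose r : ℝ) ^ 2 * (δ * (x ^ 2) ^ b) := by ring
        _ ≤ _ := by gcongr; exact hδq b
    calc _ = (δ / ((M : ℝ) + 1) ^ 2 * ((1 + x) ^ 2) ^ M) ^ (1 / (M : ℝ)) := by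
          rw [Real.mul_rpow (by positivity) (by positivity), one_div,
            Real.pow_rpow_inv_natCast (by positivity) hN0.ne']
      _ ≤ _ := Real.rpow_le_rpow (by positivity) hK (by positivity)

end Asymptotics

/-- If `q` is an indecomposable pattern of length `k ≥ 2`, `q'` is obtained from `q` by
adding 1 to each entry and prepending the entry 1, and `(S_n(q))^{1/n} → L`, then
`liminf (S_n(q'))^{1/n} ≥ 1 + L + 2√L`. -/
theorem stanley_wilf_liminf_prepend_indecomposable {k : ℕ} (hk : 2 ≤ k)
    (q : Equiv.Perm (Fin k)) (hq : Indecomposable q)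
    (q' : Equiv.Perm (Fin (k + 1)))
    (hq'0 : q' 0 = 0) (hq' : ∀ i : Fin k, q' i.succ = (q i).succ)
    (L : ℝ)
    (hL : Filter.Tendsto (fun n : ℕ => (avoiders n q : ℝ) ^ (1 / (n : ℝ)))
      Filter.atTop (nhds L)) :
    1 + L + 2 * Real.sqrt L ≤
      Filter.liminf (fun n : ℕ => (avoiders n q' : ℝ) ^ (1 / (n : ℝ))) Filter.atTop := by
  have hL1 : 1 ≤ L := ge_of_tendsto' hL fun n =>
    Real.one_le_rpow (by exact_mod_cast one_le_avoiders hk hq n) (by positivity)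
  have hsqrt : 0 < √L := Real.sqrt_pos.2 (by linarith)
  have hsq : 1 + L + 2 * √L = (1 + √L) ^ 2 := by
    rw [add_sq, Real.sq_sqrt (by linarith)]; ring
  rw [hsq]
  refine le_of_forall_lt fun c hc => ?_
  obtain ⟨d, hcd, hd⟩ := exists_between hc
  have hcont : Filter.Tendsto (fun x : ℝ => (1 + x) ^ 2) (nhdsWithin √L (Set.Iio √L))
      (nhds ((1 + √L) ^ 2)) :=
    ((by fun_prop : Continuous fun x : ℝ => (1 + x) ^ 2).tendsto _).mono_left nhdsWithin_le_nhds
  obtain ⟨x, hx, hx0, hxL⟩ :=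
    ((hcont.eventually_const_lt hd).and (Ioo_mem_nhdsLT hsqrt)).exists
  obtain ⟨C, hC⟩ := exists_frequently_avoiders_rpow_le (by omega) q'
  exact hcd.trans_le (Filter.le_liminf_of_le (Filter.IsCoboundedUnder.of_frequently_le hC)
    (eventually_le_avoiders_prepend_rpow hk hq hq'0 hq' hL hx0 ((Real.lt_sqrt hx0.le).1 hxL) hx))
end

section
/- Let q be an indecomposable pattern. Let S be a finite sequence of distinct integers whose index set is partitioned into nonempty consecutive intervals (blocks) B_1, …, B_t such that every entry in B_i is larger than every entry in B_j whenever i < j. If the subsequence of S on each block avoids q, then S avoids q. -/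
/-- If the entries of a permutation at its first `r` positions exceed all its later entries,
then they are exactly the `r` largest values. -/
theorem lt_iff_sub_le_of_forall_lt {k r : ℕ} (q : Equiv.Perm (Fin k)) (hr : r < k)
    (h : ∀ i j : Fin k, (i : ℕ) < r → r ≤ (j : ℕ) → q j < q i) (i : Fin k) :
    (i : ℕ) < r ↔ k - r ≤ (q i : ℕ) := by
  constructor
  · intro hi
    have hsub : (Finset.Ici (⟨r, hr⟩ : Fin k)).map q.toEmbedding ⊆ Finset.Iio (q i) := by
      intro x hx
      obtain ⟨j, hj, rfl⟩ := Finset.mem_map.1 hx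
      exact Finset.mem_Iio.2 (h i j hi (Fin.le_def.1 (Finset.mem_Ici.1 hj)))
    simpa using Finset.card_le_card hsub
  · intro hi
    by_contra! hri
    have hsub : (Finset.Iio (⟨r, hr⟩ : Fin k)).map q.toEmbedding ⊆ Finset.Ioi (q i) := by
      intro x hx
      obtain ⟨j, hj, rfl⟩ := Finset.mem_map.1 hx
      exact Finset.mem_Ioi.2 (h j i (Fin.lt_def.1 (Finset.mem_Iio.1 hj)) hri)
    have hcard := Finset.card_le_card hsub
    simp only [Finset.card_map, Fin.card_Iio, Fin.card_Ioi] at hcard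
    omega

/-- Let `q` be indecomposable and let `s` be a finite sequence of distinct integers whose
index set is partitioned into consecutive blocks (the fibers of the monotone block
function `b`) such that every entry in an earlier block is larger than every entry in a
later block. If the subsequence of `s` on each block avoids `q`, then `s` avoids `q`. -/
theorem avoids_of_blocks_avoid {m k : ℕ} (q : Equiv.Perm (Fin k)) (hq : Indecomposable q)
    (s : Fin m → ℤ) (hs : Function.Injective s)
    (b : Fin m → ℕ) (hb : Monotone b)
    (hdec : ∀ i j : Fin m, i < j → b i ≠ b j → s j < s i)
    (hblocks : ∀ c : ℕ, ¬ ContainsOn s (fun i => b i = c) q) :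
    ¬ ContainsOn s (fun _ => True) q := by
  rintro ⟨f, hf, -, hfq⟩
  by_cases hk : k = 0
  · subst hk
    exact hblocks 0 ⟨f, hf, fun a => a.elim0, hfq⟩
  have hk : 0 < k := Nat.pos_of_ne_zero hk
  have hne : ∃ n, ∃ h : n < k, b (f ⟨n, h⟩) ≠ b (f ⟨0, hk⟩) := by
    by_contra! hall
    exact hblocks (b (f ⟨0, hk⟩)) ⟨f, hf, fun a => hall a a.2, hfq⟩
  classical
  obtain ⟨hrk, hr⟩ := Nat.find_spec hne
  have hmin := fun n (hn : n < Nat.find hne) => Nat.find_min hne hn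
  generalize Nat.find hne = r at hrk hr hmin
  have hr0 : 1 ≤ r := Nat.one_le_iff_ne_zero.2 (by rintro rfl; exact hr rfl)
  refine hq ⟨r, hr0, hrk, lt_iff_sub_le_of_forall_lt q hrk fun i j hi hj => ?_⟩
  have hbi : b (f i) = b (f ⟨0, hk⟩) := by
    by_contra hbi
    exact hmin i hi ⟨i.2, hbi⟩
  have hb0r : b (f ⟨0, hk⟩) ≤ b (f ⟨r, hrk⟩) := hb (hf.monotone (Fin.mk_le_mk.2 r.zero_le))
  have hbrj : b (f ⟨r, hrk⟩) ≤ b (f j) := hb (hf.monotone hj)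
  exact (hfq j i).1 (hdec _ _ (hf (Fin.lt_def.2 (hi.trans_le hj))) (by omega))
end
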